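/- Let A be an algebra with Day operations m₀,…,m_n, let k ≥ 2, T = (θ₀,…,θ_{k-1}) ∈ Con(A)^k, and δ ∈ Con(A). If C(T; l; δ) holds for some l < k, then C(T; j; δ) holds for every j < k. -/

import Mathlib

namespace UACommutator

/-- A signature: a type of operation symbols with arities. -/
structure Signature where
  ops : Type
  arity : ops → ℕ

/-- An algebra for a signature: a nonempty carrier with interpretations of the operations. -/
structure Alg (σ : Signature) where
  carrier : Type
  nonempty : Nonempty carrier
  interp : (o : σ.ops) → (Fin (σ.arity o) → carrier) → carrier

/-- A congruence of an algebra: an equivalence relation compatible with all basic operations. -/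
structure Congruence {σ : Signature} (A : Alg σ) where
  rel : A.carrier → A.carrier → Prop
  iseqv : Equivalence rel
  compat : ∀ (o : σ.ops) (x y : Fin (σ.arity o) → A.carrier),
    (∀ i, rel (x i) (y i)) → rel (A.interp o x) (A.interp o y)

instance {σ : Signature} {A : Alg σ} : LE (Congruence A) :=
  ⟨fun a b => ∀ x y, a.rel x y → b.rel x y⟩

/-- Terms of the signature with variables in `V`. -/
inductive Term (σ : Signature) (V : Type) : Type
  | var : V → Term σ V
  | app : (o : σ.ops) → (Fin (σ.arity o) → Term σ V) → Term σ V

def Term.evalA {σ : Signature} (A : Alg σ) {V : Type} :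
    Term σ V → (V → A.carrier) → A.carrier
  | .var v, env => env v
  | .app o args, env => A.interp o (fun i => (args i).evalA A env)

/-- Polynomial operations of an algebra `A` with variables in `V`:
built from variables, constants of `A`, and the basic operations. -/
inductive Poly {σ : Signature} (A : Alg σ) (V : Type) : Type
  | var : V → Poly A V
  | const : A.carrier → Poly A V
  | app : (o : σ.ops) → (Fin (σ.arity o) → Poly A V) → Poly A V

def Poly.eval {σ : Signature} {A : Alg σ} {V : Type} :
    Poly A V → (V → A.carrier) → A.carrier
  | .var v, env => env v
  | .const c, _ => c
  | .app o args, env => A.interp o (fun i => (args i).eval env)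

/-- Evaluate a polynomial whose variables are grouped into `k` tuples (tuple `i` of
length `ν i`) at the tuples `a i` (where `g i = false`) or `b i` (where `g i = true`). -/
def evalTup {σ : Signature} {A : Alg σ} {k : ℕ} {ν : Fin k → ℕ}
    (p : Poly A (Σ i, Fin (ν i))) (a b : ∀ i, Fin (ν i) → A.carrier)
    (g : Fin k → Bool) : A.carrier :=
  p.eval (fun x => if g x.1 then b x.1 x.2 else a x.1 x.2)

/-- The term condition `C(α₀,…,α_{k-1}; δ)`, centralizing at coordinate `j`. -/
def TC {σ : Signature} {A : Alg σ} {k : ℕ} (α : Fin k → Congruence A) (j : Fin k)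
    (δ : Congruence A) : Prop :=
  ∀ (ν : Fin k → ℕ) (p : Poly A (Σ i, Fin (ν i)))
    (a b : ∀ i, Fin (ν i) → A.carrier),
    (∀ i mm, (α i).rel (a i mm) (b i mm)) →
    (∀ g : Fin k → Bool, g j = false → (∃ i, i ≠ j ∧ g i = false) →
      δ.rel (evalTup p a b g) (evalTup p a b (Function.update g j true))) →
    δ.rel (evalTup p a b (Function.update (fun _ => true) j false))
          (evalTup p a b (fun _ => true))

/-- The meet (intersection) of a family of congruences. -/
def infCong {σ : Signature} {A : Alg σ} {ι : Sort*} (ds : ι → Congruence A) :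
    Congruence A where
  rel x y := ∀ i, (ds i).rel x y
  iseqv := ⟨fun x i => (ds i).iseqv.refl x,
            fun h i => (ds i).iseqv.symm (h i),
            fun h h' i => (ds i).iseqv.trans (h i) (h' i)⟩
  compat o x y h := fun i => (ds i).compat o x y (fun mm => h mm i)

/-- The higher commutator `[α₀,…,α_{k-1}]` (term-condition version), as the meet of
all congruences `δ` such that `C(α₀,…,α_{k-1}; δ)` holds, centralizing at `j`. -/
def commTC {σ : Signature} {A : Alg σ} {k : ℕ} (α : Fin k → Congruence A) (j : Fin k) :
    Congruence A :=
  infCong (fun d : {δ : Congruence A // TC α j δ} => d.val)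

/-- The congruence generated by a binary relation `X`. -/
def Cg {σ : Signature} {A : Alg σ} (X : A.carrier → A.carrier → Prop) : Congruence A :=
  infCong (fun d : {δ : Congruence A // ∀ x y, X x y → δ.rel x y} => d.val)

theorem Cg_base {σ : Signature} {A : Alg σ} (X : A.carrier → A.carrier → Prop)
    {x y : A.carrier} (h : X x y) : (Cg X).rel x y :=
  fun i => i.2 x y h

/-- The join of a family of congruences: the least congruence containing every member. -/
def supCong {σ : Signature} {A : Alg σ} {ι : Sort*} (γ : ι → Congruence A) :
    Congruence A :=
  Cg (fun x y => ∃ i, (γ i).rel x y)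

/-- The join of two congruences. -/
def joinCong {σ : Signature} {A : Alg σ} (a b : Congruence A) : Congruence A :=
  Cg (fun x y => a.rel x y ∨ b.rel x y)

/-- `m` is a `T`-matrix for `T = (θ₀,…,θ_{k-1})`. -/
def IsMatrix {σ : Signature} {A : Alg σ} {k : ℕ} (θ : Fin k → Congruence A)
    (m : (Fin k → Bool) → A.carrier) : Prop :=
  ∃ (ν : Fin k → ℕ) (p : Poly A (Σ i, Fin (ν i))) (a b : ∀ i, Fin (ν i) → A.carrier),
    (∀ i jj, (θ i).rel (a i jj) (b i jj)) ∧
    ∀ f : Fin k → Bool, m f = evalTup p a b f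

/-- The matrix centralization condition `C(T; j; δ)`: for every `T`-matrix, if every
`(j)`-supporting line is a `δ`-pair then the `(j)`-pivot line is a `δ`-pair. -/
def CMat {σ : Signature} {A : Alg σ} {k : ℕ} (θ : Fin k → Congruence A) (j : Fin k)
    (δ : Congruence A) : Prop :=
  ∀ m : (Fin k → Bool) → A.carrier, IsMatrix θ m →
    (∀ g : Fin k → Bool, (∃ i, i ≠ j ∧ g i = false) →
      δ.rel (m (Function.update g j false)) (m (Function.update g j true))) →
    δ.rel (m (Function.update (fun _ => true) j false)) (m (fun _ => true))

/-- `[T]_j`: the meet of all congruences `δ` with `C(T; j; δ)`. -/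
def commMat {σ : Signature} {A : Alg σ} {k : ℕ} (θ : Fin k → Congruence A) (j : Fin k) :
    Congruence A :=
  infCong (fun d : {δ : Congruence A // CMat θ j δ} => d.val)

/-- Day operations `m₀, …, m_n` for an algebra, each induced by a term of the signature. -/
structure DayOps {σ : Signature} (A : Alg σ) (n : ℕ) where
  m : Fin (n+1) → A.carrier → A.carrier → A.carrier → A.carrier → A.carrier
  isTerm : ∀ e, ∃ t : Term σ (Fin 4), ∀ x y z u, m e x y z u = t.evalA A ![x, y, z, u]
  idem : ∀ e x y, m e x y y x = x
  first : ∀ x y z u, m 0 x y z u = x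
  last : ∀ x y z u, m (Fin.last n) x y z u = u
  even : ∀ (e : ℕ) (he : e < n), Even e → ∀ x u,
    m ⟨e, by omega⟩ x x u u = m ⟨e+1, by omega⟩ x x u u
  odd : ∀ (e : ℕ) (he : e < n), Odd e → ∀ x y u,
    m ⟨e, by omega⟩ x y y u = m ⟨e+1, by omega⟩ x y y u

/-- The `e`-th shift rotation at `(j, l)` of a cube `h`. -/
def shiftRot {σ : Signature} {A : Alg σ} {n k : ℕ} (D : DayOps A n) (e : Fin (n+1))
    (j l : Fin k) (h : (Fin k → Bool) → A.carrier) :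
    (Fin k → Bool) → A.carrier := fun f =>
  let r := h (Function.update (Function.update f j false) l false)
  let s := h (Function.update (Function.update f j false) l true)
  let u := h (Function.update (Function.update f j true) l false)
  let v := h (Function.update (Function.update f j true) l true)
  if f j then (if f l then D.m e s s v v else D.m e s r u v) else s

/-- `hIter D m hm d h` is `h^{(d₀,…,d_{m-1})}`: the result of applying the shift
rotations `R^{d₀}_{0,1}, …, R^{d_{m-1}}_{m-1,m}` successively to `h`. -/
def hIter {σ : Signature} {A : Alg σ} {n k : ℕ} (D : DayOps A n) :
    (m : ℕ) → m < k → (Fin m → Fin (n+1)) → ((Fin k → Bool) → A.carrier) →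
    ((Fin k → Bool) → A.carrier)
  | 0, _, _, h => h
  | (m+1), hm, d, h =>
      shiftRot D (d (Fin.last m)) ⟨m, by omega⟩ ⟨m+1, hm⟩
        (hIter D m (by omega) (fun i => d i.castSucc) h)

/-- `X(T)`: the set of `(k-1)`-pivot lines of the matrices `h^d`, over all `T`-matrices
`h` and all `d ∈ {0,…,n}^{k-1}`. -/
def XSet {σ : Signature} {A : Alg σ} {n k : ℕ} (hk : 0 < k) (D : DayOps A n)
    (θ : Fin k → Congruence A) : A.carrier → A.carrier → Prop :=
  fun x y => ∃ h : (Fin k → Bool) → A.carrier, IsMatrix θ h ∧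
    ∃ d : Fin (k-1) → Fin (n+1),
      x = hIter D (k-1) (by omega) d h
            (Function.update (fun _ => true) (⟨k-1, by omega⟩ : Fin k) false) ∧
      y = hIter D (k-1) (by omega) d h (fun _ => true)

/-- Product algebra `A^I` with pointwise operations. -/
def prodAlg {σ : Signature} (A : Alg σ) (I : Type) : Alg σ where
  carrier := I → A.carrier
  nonempty := ⟨fun _ => Classical.choice A.nonempty⟩
  interp o x := fun i => A.interp o (fun mm => x mm i)

/-- Membership in the subalgebra of `B` generated by a set `S`. -/
inductive Gen {σ : Signature} (B : Alg σ) (S : Set B.carrier) : B.carrier → Prop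
  | base : ∀ x ∈ S, Gen B S x
  | app : ∀ (o : σ.ops) (x : Fin (σ.arity o) → B.carrier),
      (∀ i, Gen B S (x i)) → Gen B S (B.interp o x)

/-- `f : A → B` is a homomorphism. -/
def IsHom {σ : Signature} (A B : Alg σ) (f : A.carrier → B.carrier) : Prop :=
  ∀ (o : σ.ops) (x : Fin (σ.arity o) → A.carrier),
    f (A.interp o x) = B.interp o (fun i => f (x i))

/-- The kernel congruence of a homomorphism. -/
def kerCong {σ : Signature} {A B : Alg σ} (f : A.carrier → B.carrier)
    (hf : IsHom A B f) : Congruence A where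
  rel x y := f x = f y
  iseqv := ⟨fun _ => rfl, Eq.symm, Eq.trans⟩
  compat o x y h := by
    show f (A.interp o x) = f (A.interp o y)
    rw [hf o x, hf o y]
    congr 1
    funext i
    exact h i

/-- The image `f(γ)` of a congruence `γ ≥ ker f` under a surjective homomorphism `f`. -/
def mapCong {σ : Signature} {A B : Alg σ} (f : A.carrier → B.carrier)
    (hf : IsHom A B f) (hs : Function.Surjective f) (γ : Congruence A)
    (hγ : ∀ x y, f x = f y → γ.rel x y) : Congruence B where
  rel u v := ∃ x y, γ.rel x y ∧ f x = u ∧ f y = v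
  iseqv := by
    refine ⟨?_, ?_, ?_⟩
    · intro u
      obtain ⟨x, hx⟩ := hs u
      exact ⟨x, x, γ.iseqv.refl x, hx, hx⟩
    · rintro u v ⟨x, y, hxy, hx, hy⟩
      exact ⟨y, x, γ.iseqv.symm hxy, hy, hx⟩
    · rintro u v w ⟨x, y, hxy, hx, hy⟩ ⟨y', z, hyz, hy', hz⟩
      exact ⟨x, z, γ.iseqv.trans hxy (γ.iseqv.trans (hγ y y' (hy.trans hy'.symm)) hyz),
        hx, hz⟩
  compat o u v h := by
    choose x y hxy hx hy using h
    refine ⟨A.interp o x, A.interp o y, γ.compat o x y hxy, ?_, ?_⟩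
    · rw [hf o x]
      congr 1
      funext i
      exact hx i
    · rw [hf o y]
      congr 1
      funext i
      exact hy i

/-- The preimage `f⁻¹(β)` of a congruence of `B` under a homomorphism `f`. -/
def comapCong {σ : Signature} {A B : Alg σ} (f : A.carrier → B.carrier)
    (hf : IsHom A B f) (β : Congruence B) : Congruence A where
  rel x y := β.rel (f x) (f y)
  iseqv := ⟨fun _ => β.iseqv.refl _, β.iseqv.symm, β.iseqv.trans⟩
  compat o x y h := by
    show β.rel (f (A.interp o x)) (f (A.interp o y))
    rw [hf o x, hf o y]
    exact β.compat o _ _ h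

theorem Congruence.evalA_rel {σ : Signature} {A : Alg σ} (δ : Congruence A) {V : Type}
    (t : Term σ V) {x y : V → A.carrier} (h : ∀ v, δ.rel (x v) (y v)) :
    δ.rel (t.evalA A x) (t.evalA A y) := by
  induction t with
  | var v => exact h v
  | app o args ih => exact δ.compat o _ _ ih

theorem DayOps.rel {σ : Signature} {A : Alg σ} {n : ℕ} (D : DayOps A n) (δ : Congruence A)
    (e : Fin (n + 1)) {x y z u x' y' z' u' : A.carrier} (hx : δ.rel x x') (hy : δ.rel y y')
    (hz : δ.rel z z') (hu : δ.rel u u') : δ.rel (D.m e x y z u) (D.m e x' y' z' u') := by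
  obtain ⟨t, ht⟩ := D.isTerm e
  rw [ht, ht]
  refine δ.evalA_rel t fun v => ?_
  fin_cases v
  exacts [hx, hy, hz, hu]

/-- Day's criterion for membership in a congruence. -/
theorem DayOps.rel_of_forall {σ : Signature} {A : Alg σ} {n : ℕ} (D : DayOps A n)
    (δ : Congruence A) {x y z u : A.carrier} (hyz : δ.rel y z)
    (h : ∀ e, δ.rel (D.m e x y z u) (D.m e x x u u)) : δ.rel x u := by
  have key : ∀ e (he : e < n + 1), δ.rel x (D.m ⟨e, he⟩ x x u u) := by
    intro e
    induction e with
    | zero =>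
      intro he
      have h0 : D.m ⟨0, he⟩ x x u u = x := D.first x x u u
      rw [h0]
      exact δ.iseqv.refl x
    | succ e ih =>
      intro he
      have hx := ih (by omega)
      rcases Nat.even_or_odd e with hev | hodd
      · rwa [← D.even e (by omega) hev]
      · have hstep : ∀ i : Fin (n + 1), δ.rel (D.m i x x u u) (D.m i x y y u) := fun i =>
          δ.iseqv.trans (δ.iseqv.symm (h i))
            (D.rel δ i (δ.iseqv.refl _) (δ.iseqv.refl _) (δ.iseqv.symm hyz) (δ.iseqv.refl _))
        have h₁ := hstep ⟨e, by omega⟩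
        rw [D.odd e (by omega) hodd] at h₁
        exact δ.iseqv.trans hx (δ.iseqv.trans h₁ (δ.iseqv.symm (hstep _)))
  have hn := key n (Nat.lt_succ_self n)
  have hlast : D.m ⟨n, Nat.lt_succ_self n⟩ x x u u = u := D.last x x u u
  rwa [hlast] at hn

/-- Substitution of polynomials for the variables of a polynomial. -/
def Poly.bind {σ : Signature} {A : Alg σ} {V W : Type} : Poly A V → (V → Poly A W) → Poly A W
  | .var v, s => s v
  | .const c, _ => .const c
  | .app o args, s => .app o fun i => (args i).bind s

theorem Poly.eval_bind {σ : Signature} {A : Alg σ} {V W : Type} (p : Poly A V)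
    (s : V → Poly A W) (env : W → A.carrier) :
    (p.bind s).eval env = p.eval fun v => (s v).eval env := by
  induction p with
  | var v => rfl
  | const c => rfl
  | app o args ih => simp only [Poly.bind, Poly.eval, ih]

/-- Substitution of polynomials for the variables of a term. -/
def Term.bindPoly {σ : Signature} {A : Alg σ} {V W : Type} :
    Term σ V → (V → Poly A W) → Poly A W
  | .var v, s => s v
  | .app o args, s => .app o fun i => (args i).bindPoly s

theorem Term.eval_bindPoly {σ : Signature} {A : Alg σ} {V W : Type} (t : Term σ V)
    (s : V → Poly A W) (env : W → A.carrier) :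
    (t.bindPoly s).eval env = t.evalA A fun v => (s v).eval env := by
  induction t with
  | var v => rfl
  | app o args ih => simp only [Term.bindPoly, Poly.eval, Term.evalA, ih]

theorem exists_evalTup_update {σ : Signature} {A : Alg σ} {k : ℕ} {ν : Fin k → ℕ}
    (p : Poly A (Σ i, Fin (ν i))) (a b : ∀ i, Fin (ν i) → A.carrier) (i : Fin k) (ε : Bool) :
    ∃ q : Poly A (Σ i, Fin (ν i)), ∀ g,
      evalTup q a b g = evalTup p a b (Function.update g i ε) := by
  refine ⟨p.bind fun x => if x.1 = i then .const (if ε then b x.1 x.2 else a x.1 x.2) else .var x,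
    fun g => ?_⟩
  simp only [evalTup, Poly.eval_bind]
  congr 1
  funext x
  by_cases hx : x.1 = i <;> simp [hx, Poly.eval]

theorem IsMatrix.day_rotation {σ : Signature} {A : Alg σ} {n k : ℕ} (D : DayOps A n)
    (e : Fin (n + 1)) {θ : Fin k → Congruence A} {h : (Fin k → Bool) → A.carrier}
    (hh : IsMatrix θ h) (j l : Fin k) :
    IsMatrix θ fun f =>
      D.m e (h (Function.update (Function.update f l true) j false)) (h (Function.update f j false))
        (h f) (h (Function.update f l true)) := by
  obtain ⟨ν, p, a, b, hab, hp⟩ := hh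
  obtain ⟨t, ht⟩ := D.isTerm e
  obtain ⟨q₁, hq₁⟩ := exists_evalTup_update p a b j false
  obtain ⟨q₀, hq₀⟩ := exists_evalTup_update q₁ a b l true
  obtain ⟨q₃, hq₃⟩ := exists_evalTup_update p a b l true
  refine ⟨ν, t.bindPoly ![q₀, q₁, p, q₃], a, b, hab, fun f => ?_⟩
  simp only [ht, hp, ← hq₁, ← hq₀, ← hq₃]
  refine Eq.trans ?_ (Term.eval_bindPoly t _ _).symm
  congr 1
  funext v
  fin_cases v <;> rfl

theorem CMat.of_ne {σ : Signature} {A : Alg σ} {n k : ℕ} (D : DayOps A n)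
    {θ : Fin k → Congruence A} {δ : Congruence A} {j l : Fin k} (hjl : j ≠ l)
    (hl : CMat θ l δ) : CMat θ j δ := by
  intro h hh hsupp
  have hline : ∀ g : Fin k → Bool, (∃ i, i ≠ j ∧ g i = false) →
      δ.rel (h (Function.update g j false)) (h g) := by
    intro g hg
    cases hgj : g j with
    | false =>
      rw [← hgj, Function.update_eq_self]
      exact δ.iseqv.refl _
    | true =>
      have := hsupp g hg
      rwa [← hgj, Function.update_eq_self] at this
  refine D.rel_of_forall δ (hline (Function.update (fun _ => true) l false)
    ⟨l, hjl.symm, Function.update_self ..⟩) fun e => ?_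
  have hpiv := hl _ (hh.day_rotation D e j l) ?_
  · simpa only [Function.update_idem, Function.update_eq_self] using hpiv
  rintro g ⟨i, hil, hi⟩
  simp only [Function.update_idem]
  rcases eq_or_ne i j with rfl | hij
  · have hfix : ∀ ε, Function.update (Function.update g l ε) i false = Function.update g l ε :=
      fun ε => by rw [Function.update_eq_self_iff, Function.update_of_ne hil, hi]
    simp only [hfix, D.idem]
    exact δ.iseqv.refl _
  · have hs : ∀ ε, δ.rel (h (Function.update (Function.update g l ε) j false))
        (h (Function.update g l ε)) := fun ε =>
      hline _ ⟨i, hij, by rw [Function.update_of_ne hil, hi]⟩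
    have hcollapse : ∀ ε, δ.rel
        (D.m e (h (Function.update (Function.update g l true) j false))
          (h (Function.update (Function.update g l ε) j false))
          (h (Function.update g l ε)) (h (Function.update g l true)))
        (h (Function.update (Function.update g l true) j false)) := by
      intro ε
      have := D.rel δ e
        (δ.iseqv.refl (h (Function.update (Function.update g l true) j false)))
        (δ.iseqv.refl (h (Function.update (Function.update g l ε) j false)))
        (δ.iseqv.symm (hs ε)) (δ.iseqv.symm (hs true))
      rwa [D.idem] at this
    exact δ.iseqv.trans (hcollapse false) (δ.iseqv.symm (hcollapse true))

theorem centralize_all_coords {σ : Signature} (A : Alg σ) (n : ℕ) (D : DayOps A n)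
    (k : ℕ) (hk : 2 ≤ k) (θ : Fin k → Congruence A) (δ : Congruence A)
    (l : Fin k) (hl : CMat θ l δ) :
    ∀ j : Fin k, CMat θ j δ := by
  intro j
  rcases eq_or_ne j l with rfl | hjl
  · exact hl
  · exact hl.of_ne D hjl

end UACommutator
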